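/- The dual eigenvalues of the non-binary Johnson scheme satisfy the second recurrence relation: for integers r ≥ 3 and 1 ≤ k ≤ n−1, for all natural numbers i, j with i + j ≤ k, all natural numbers y with y ≤ k−i and y ≤ n−k, and all x ∈ ℚ, provided n ∉ {i+2j−3, i+2j−2, i+2j, i+2j+1}, one has μ*(x,y)·q_{ij}(x,y) = Â_{ij}·q_{i,j+1}(x,y) + B̂_{ij}·q_{ij}(x,y) + Ĉ_{ij}·q_{i,j−1}(x,y), where μ*(x,y) = (n−1)(1 − n·y/(k(n−k))), Â_{ij} = (n−1)n(j+k−n)(i+j−k)(j+1)/(k(n−k)(2j+i−n)(2j+i−n+1)), B̂_{ij} = n−1 − (n−1)n(j²(n−i) − j(n−i)(n−i+1) + (k−i)(n−i+2)(n−k))/(k(n−k)(2j+i−n−2)(2j+i−n)), and Ĉ_{ij} = −(n−1)n(j+k−n−1)(i+j−k−1)(i+j−n−2)/(k(n−k)(2j+i−n−2)(2j+i−n−3)). -/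

import Mathlib

/-- Generalized binomial coefficient `C(z, l) = z (z-1) ⋯ (z-l+1) / l!` for `z : ℚ`. -/
noncomputable def qchoose (z : ℚ) (l : ℕ) : ℚ :=
  (∏ m ∈ Finset.range l, (z - m)) / (Nat.factorial l : ℚ)

/-- Krawtchouk polynomial `K_i(x, N, p)`. -/
noncomputable def Kraw (i : ℕ) (x N p : ℚ) : ℚ :=
  ∑ l ∈ Finset.range (i + 1),
    (-1 : ℚ) ^ l * (p - 1) ^ (i - l) * qchoose x l * qchoose (N - x) (i - l)

/-- Eberlein polynomial `E_i(x, N, p)`. -/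
noncomputable def Eber (i : ℕ) (x N p : ℚ) : ℚ :=
  ∑ l ∈ Finset.range (i + 1),
    (-1 : ℚ) ^ l * qchoose x l * qchoose (p - x) (i - l) * qchoose (N - p - x) (i - l)

/-- Hahn polynomial `H_i(x, N, p) = ((C(N,i) - C(N,i-1)) / (C(p,x) C(N-p,x))) E_x(i, N, p)`,
with the convention `C(N, -1) = 0`. -/
noncomputable def Hahn (i x : ℕ) (N p : ℚ) : ℚ :=
  ((qchoose N i - if i = 0 then 0 else qchoose N (i - 1)) / (qchoose p x * qchoose (N - p) x))
    * Eber x (i : ℚ) N p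

/-- Krawtchouk polynomial with an integer index, with the convention `K_{-1} := 0`. -/
noncomputable def KrawZ (i : ℤ) (x N p : ℚ) : ℚ :=
  if i < 0 then 0 else Kraw i.toNat x N p

/-- Hahn polynomial with an integer index, with the convention `H_{-1} := 0`. -/
noncomputable def HahnZ (i : ℤ) (x : ℕ) (N p : ℚ) : ℚ :=
  if i < 0 then 0 else Hahn i.toNat x N p

/-- Dual eigenvalues `q_{ij}(x, y)` of the non-binary Johnson scheme `J_r(k, n)`,
with the convention `q_{ij} := 0` if `i < 0` or `j < 0`. -/
noncomputable def qdual (r n k : ℤ) (i j : ℤ) (x : ℚ) (y : ℕ) : ℚ :=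
  if i < 0 ∨ j < 0 then 0 else
    (qchoose (n : ℚ) i.toNat / qchoose (k : ℚ) i.toNat)
      * Kraw i.toNat x ((k : ℚ) - y) ((r : ℚ) - 1)
      * Hahn j.toNat y ((n : ℚ) - (i : ℚ)) ((k : ℚ) - (i : ℚ))

theorem qchoose_zero (z : ℚ) : qchoose z 0 = 1 := by
  simp [qchoose]

theorem qchoose_succ (z : ℚ) (l : ℕ) :
    qchoose z (l + 1) = qchoose z l * (z - l) / (l + 1) := by
  have hl : (l : ℚ) + 1 ≠ 0 := by positivity
  have hf : (Nat.factorial l : ℚ) ≠ 0 := by positivity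
  simp only [qchoose, Finset.prod_range_succ, Nat.factorial_succ]
  push_cast
  field_simp

/-- `C(z, l - 1)`, with the convention `C(z, -1) = 0`. -/
noncomputable def qchoosePred (z : ℚ) : ℕ → ℚ
  | 0 => 0
  | l + 1 => qchoose z l

theorem qchoose_add_one (z : ℚ) (l : ℕ) :
    qchoose (z + 1) l = qchoose z l + qchoosePred z l := by
  induction l with
  | zero => simp [qchoose_zero, qchoosePred]
  | succ l ih =>
    have hl : (l : ℚ) + 1 ≠ 0 := by positivity
    rw [qchoose_succ, ih, qchoosePred, qchoose_succ]
    cases l with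
    | zero => simp [qchoose_zero, qchoosePred]
    | succ l =>
      have hl' : (l : ℚ) + 1 ≠ 0 := by positivity
      rw [qchoosePred, qchoose_succ]
      push_cast at hl ⊢
      field_simp
      ring

theorem mul_qchoose_sub_one (z : ℚ) (l : ℕ) :
    z * qchoose (z - 1) l = (z - l) * qchoose z l := by
  induction l with
  | zero => simp [qchoose_zero]
  | succ l ih =>
    rw [qchoose_succ, qchoose_succ]
    push_cast
    linear_combination (z - 1 - l) / (l + 1) * ih

theorem exists_qchoose_eq_mul {z : ℚ} {l : ℕ} (h : l = 0 → z + 1 ≠ 0) :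
    ∃ u : ℚ, qchoose z l = (z - l + 1) * u ∧ qchoosePred z l = l * u := by
  cases l with
  | zero =>
    have hz := h rfl
    refine ⟨1 / (z + 1), ?_, by simp [qchoosePred]⟩
    rw [qchoose_zero]
    push_cast
    field_simp
    ring
  | succ l =>
    have hl : (l : ℚ) + 1 ≠ 0 := by positivity
    refine ⟨qchoose z l / (l + 1), ?_, ?_⟩
    · rw [qchoose_succ]
      push_cast
      ring
    · rw [qchoosePred]
      push_cast
      field_simp

/-- Polynomial part of the certificate by which the recurrence for Eberlein polynomials
telescopes. -/
def eberCertificate (z a b y l : ℚ) : ℚ :=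
  (z + 1) * (a + b + 2) * l ^ 2
    + ((a + b) * (3 + 2 * (a + b) + a * b) + 2 * z * (a + b) * (a + b + 2)
        - (a + b + 2) * (a + b + 2 + 2 * z) * y) * l
    + (a + b + 2) * (a + b + 1 + z) * y ^ 2
    - (a + b) * (a + b + 2) * (a + b + 2 + 2 * z) * y
    + (1 + z) * ((a + b) * (1 + a + b) ^ 2 + 2 * a * b) + a * b * (a + b) * (a + b + 2)

theorem eber_summand_telescopes {z : ℚ} (hz : z + 1 ≠ 0) (a b : ℚ) (l m : ℕ) :
    ((z ^ 2 * (a + b + 2 * z) - z * (a + b + 2 * z) * (a + b + 2 * z + 1)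
          + (a + z) * (b + z) * (a + b + 2 * z + 2) - ((l : ℚ) + m) * (a + b) * (a + b + 2))
        * (a + b + 1)) * (qchoose z l * qchoose a m * qchoose b m)
      - (a + b + z + 1) * (a + b + 2)
          * (qchoose (z + 1) l * (a * qchoose (a - 1) m) * (b * qchoose (b - 1) m))
      - (a + b) * (a + 1) * (b + 1)
          * ((z * qchoose (z - 1) l) * qchoose (a + 1) m * qchoose (b + 1) m)
    = -(eberCertificate z a b (l + m) (l + 1) * (qchoose z l * qchoosePred a m * qchoosePred b m))
      - eberCertificate z a b (l + m) l * (qchoosePred z l * qchoose a m * qchoose b m) := by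
  rw [mul_qchoose_sub_one, mul_qchoose_sub_one, mul_qchoose_sub_one, qchoose_add_one,
    qchoose_add_one, qchoose_add_one]
  obtain ⟨u, hu, hu'⟩ := exists_qchoose_eq_mul (l := l) fun _ => hz
  rw [hu, hu']
  cases m with
  | zero =>
    simp only [qchoose_zero, qchoosePred, eberCertificate]
    push_cast
    ring
  | succ m =>
    obtain ⟨s, hs, hs'⟩ := exists_qchoose_eq_mul (z := a) (l := m + 1) fun h => by omega
    obtain ⟨t, ht, ht'⟩ := exists_qchoose_eq_mul (z := b) (l := m + 1) fun h => by omega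
    rw [hs, hs', ht, ht', eberCertificate, eberCertificate]
    ring

theorem eber_recurrence {z : ℚ} (hz : z + 1 ≠ 0) (y : ℕ) (N p : ℚ) :
    (z ^ 2 * N - z * N * (N + 1) + p * (N + 2) * (N - p)
        - y * (N - 2 * z) * (N - 2 * z + 2)) * (N - 2 * z + 1) * Eber y z N p
    = (N - z + 1) * (N - 2 * z + 2) * (p - z) * (N - p - z) * Eber y (z + 1) N p
      + z * (p - z + 1) * (N - p - z + 1) * (N - 2 * z) * Eber y (z - 1) N p := by
  obtain ⟨a, rfl⟩ : ∃ a, p = a + z := ⟨p - z, by ring⟩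
  obtain ⟨b, rfl⟩ : ∃ b, N = a + b + 2 * z := ⟨N - a - 2 * z, by ring⟩
  let G : ℕ → ℚ := fun l => (-1) ^ l * eberCertificate z a b y l * qchoosePred z l
    * qchoosePred a (y + 1 - l) * qchoosePred b (y + 1 - l)
  have hG : ∑ l ∈ Finset.range (y + 1), (G (l + 1) - G l) = 0 := by
    rw [Finset.sum_range_sub]
    simp [G, qchoosePred]
  rw [← sub_eq_zero, ← hG, Eber, Eber, Eber, Finset.mul_sum, Finset.mul_sum, Finset.mul_sum,
    ← Finset.sum_add_distrib, ← Finset.sum_sub_distrib]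
  refine Finset.sum_congr rfl fun l hl => ?_
  obtain ⟨m, rfl⟩ := Nat.exists_eq_add_of_le (Nat.lt_succ_iff.mp (Finset.mem_range.mp hl))
  have key := eber_summand_telescopes hz a b l m
  have e1 : l + m - l = m := by omega
  have e2 : l + m + 1 - l = m + 1 := by omega
  have e3 : l + m + 1 - (l + 1) = m := by omega
  have p0 : ∀ (w : ℚ) (i : ℕ), qchoosePred w (i + 1) = qchoose w i := fun _ _ => rfl
  simp only [G, e1, e2, e3, p0]
  have a0 : a + z - z = a := by ring
  have a1 : a + z - (z + 1) = a - 1 := by ring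
  have a2 : a + z - (z - 1) = a + 1 := by ring
  have b0 : a + b + 2 * z - (a + z) - z = b := by ring
  have b1 : a + b + 2 * z - (a + z) - (z + 1) = b - 1 := by ring
  have b2 : a + b + 2 * z - (a + z) - (z - 1) = b + 1 := by ring
  rw [a0, a1, a2, b0, b1, b2]
  push_cast
  rw [pow_succ]
  linear_combination (-1) ^ l * key

theorem qchoose_sub_pred {N : ℚ} {j : ℕ} (h : N - j + 1 ≠ 0) :
    (qchoose N j - if j = 0 then 0 else qchoose N (j - 1))
      = qchoose N j * (N - 2 * j + 1) / (N - j + 1) := by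
  cases j with
  | zero =>
    rw [eq_div_iff h]
    simp
  | succ j =>
    have hj : (j : ℚ) + 1 ≠ 0 := by positivity
    push_cast at h
    have h' : N - j ≠ 0 := by
      intro h0
      apply h
      linear_combination h0
    rw [eq_div_iff (by push_cast; exact h)]
    simp only [Nat.succ_ne_zero, if_false, Nat.add_sub_cancel, qchoose_succ]
    push_cast
    field_simp
    ring

theorem hahn_eq {N : ℚ} {j : ℕ} (h : N - j + 1 ≠ 0) (y : ℕ) (p : ℚ) :
    Hahn j y N p = qchoose N j * (N - 2 * j + 1) / (N - j + 1)
      / (qchoose p y * qchoose (N - p) y) * Eber y j N p := by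
  rw [Hahn, qchoose_sub_pred h]

theorem hahn_recurrence {N : ℚ} {j : ℕ} (hN : (j : ℚ) < N) (y : ℕ) (p : ℚ)
    (h1 : 2 * (j : ℚ) - N ≠ 0) (h2 : 2 * (j : ℚ) - N + 1 ≠ 0)
    (h3 : 2 * (j : ℚ) - N - 2 ≠ 0) (h4 : 2 * (j : ℚ) - N - 3 ≠ 0) :
    -y * Hahn j y N p
      = ((j : ℚ) + p - N) * (j - p) * (j + 1) / ((2 * j - N) * (2 * j - N + 1))
          * Hahn (j + 1) y N p
        - ((j : ℚ) ^ 2 * N - j * N * (N + 1) + p * (N + 2) * (N - p))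
            / ((2 * j - N - 2) * (2 * j - N)) * Hahn j y N p
        - ((j : ℚ) + p - N - 1) * (j - p - 1) * (j - N - 2) / ((2 * j - N - 2) * (2 * j - N - 3))
            * HahnZ ((j : ℤ) - 1) y N p := by
  have hj : (0 : ℚ) ≤ j := Nat.cast_nonneg j
  have n0 : N - j ≠ 0 := by linarith
  have n1 : N - j + 1 ≠ 0 := by linarith
  have n2 : N - j + 2 ≠ 0 := by linarith
  have hj1 : (j : ℚ) + 1 ≠ 0 := by positivity
  have key := eber_recurrence hj1 y N p
  have hup : Hahn (j + 1) y N p = qchoose N j * (N - 2 * j - 1) / (j + 1)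
      / (qchoose p y * qchoose (N - p) y) * Eber y (j + 1) N p := by
    rw [hahn_eq (by push_cast; ring_nf at n0 ⊢; exact n0), qchoose_succ]
    push_cast
    have : N - (j + 1) + 1 = N - (j : ℚ) := by ring
    rw [this]
    congr 2
    field_simp
    ring
  have hdown : (j - N - 2) * HahnZ ((j : ℤ) - 1) y N p
      = -(qchoose N j * j * (N - 2 * j + 3) / (N - j + 1))
        / (qchoose p y * qchoose (N - p) y) * Eber y (j - 1) N p := by
    cases j with
    | zero => simp [HahnZ]
    | succ j =>
      push_cast at *
      have hj0 : (0 : ℤ) ≤ j := Int.natCast_nonneg j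
      have e : N - (j + 1) + 1 = N - (j : ℚ) := by ring
      rw [e] at n1 ⊢
      have n2' : N - j + 1 ≠ 0 := by
        intro h0
        apply n2
        linear_combination h0
      rw [HahnZ, add_sub_cancel_right, add_sub_cancel_right, if_neg (by omega), Int.toNat_natCast,
        hahn_eq n2', qchoose_succ]
      field_simp
      ring
  have hmul : ((j : ℚ) + p - N - 1) * (j - p - 1) * (j - N - 2)
        / ((2 * j - N - 2) * (2 * j - N - 3)) * HahnZ ((j : ℤ) - 1) y N p
      = ((j : ℚ) + p - N - 1) * (j - p - 1) / ((2 * j - N - 2) * (2 * j - N - 3))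
        * ((j - N - 2) * HahnZ ((j : ℤ) - 1) y N p) := by ring
  rw [hmul, hdown, hup, hahn_eq n1]
  generalize Eber y j N p = E0 at *
  generalize Eber y (j + 1) N p = E1 at *
  generalize Eber y (j - 1) N p = E2 at *
  simp only [div_eq_mul_inv _ (qchoose p y * qchoose (N - p) y)]
  generalize (qchoose p y * qchoose (N - p) y)⁻¹ = W at *
  generalize qchoose N j = c at *
  linear_combination (norm := (field_simp; ring))
    c * W / ((N - j + 1) * (2 * j - N) * (2 * j - N - 2)) * key

/-- Second recurrence relation for the dual eigenvalues of the non-binary Johnson scheme. -/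
theorem qdual_second_recurrence (r n k : ℤ) (hr : 3 ≤ r) (hk1 : 1 ≤ k) (hkn : k ≤ n - 1)
    (i j : ℕ) (hij : (i : ℤ) + j ≤ k)
    (y : ℕ) (hy1 : (y : ℤ) ≤ k - i) (hy2 : (y : ℤ) ≤ n - k)
    (x : ℚ)
    (h1 : n ≠ (i : ℤ) + 2 * j - 3) (h2 : n ≠ (i : ℤ) + 2 * j - 2)
    (h3 : n ≠ (i : ℤ) + 2 * j) (h4 : n ≠ (i : ℤ) + 2 * j + 1) :
    (((n : ℚ) - 1) * (1 - (n : ℚ) * y / ((k : ℚ) * ((n : ℚ) - k)))) * qdual r n k i j x y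
  = (((n : ℚ) - 1) * n * ((j : ℚ) + k - n) * ((i : ℚ) + j - k) * ((j : ℚ) + 1)
      / ((k : ℚ) * ((n : ℚ) - k) * (2 * (j : ℚ) + i - n) * (2 * (j : ℚ) + i - n + 1)))
      * qdual r n k i ((j : ℤ) + 1) x y
  + ((n : ℚ) - 1
      - ((n : ℚ) - 1) * n * ((j : ℚ) ^ 2 * ((n : ℚ) - i) - (j : ℚ) * ((n : ℚ) - i) * ((n : ℚ) - i + 1)
          + ((k : ℚ) - i) * ((n : ℚ) - i + 2) * ((n : ℚ) - k))
      / ((k : ℚ) * ((n : ℚ) - k) * (2 * (j : ℚ) + i - n - 2) * (2 * (j : ℚ) + i - n)))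
      * qdual r n k i j x y
  + (-(((n : ℚ) - 1) * n * ((j : ℚ) + k - n - 1) * ((i : ℚ) + j - k - 1) * ((i : ℚ) + j - n - 2)
      / ((k : ℚ) * ((n : ℚ) - k) * (2 * (j : ℚ) + i - n - 2) * (2 * (j : ℚ) + i - n - 3))))
      * qdual r n k i ((j : ℤ) - 1) x y := by
  have hn : (i : ℤ) + j < n := by omega
  have c1 : 2 * (j : ℚ) - ((n : ℚ) - i) ≠ 0 := by
    have : 2 * (j : ℤ) - (n - i) ≠ 0 := by omega
    exact_mod_cast this
  have c2 : 2 * (j : ℚ) - ((n : ℚ) - i) + 1 ≠ 0 := by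
    have : 2 * (j : ℤ) - (n - i) + 1 ≠ 0 := by omega
    exact_mod_cast this
  have c3 : 2 * (j : ℚ) - ((n : ℚ) - i) - 2 ≠ 0 := by
    have : 2 * (j : ℤ) - (n - i) - 2 ≠ 0 := by omega
    exact_mod_cast this
  have c4 : 2 * (j : ℚ) - ((n : ℚ) - i) - 3 ≠ 0 := by
    have : 2 * (j : ℤ) - (n - i) - 3 ≠ 0 := by omega
    exact_mod_cast this
  have hN : (j : ℚ) < (n : ℚ) - i := by
    have : (j : ℤ) < n - i := by omega
    exact_mod_cast this
  have key := hahn_recurrence hN y ((k : ℚ) - i) c1 c2 c3 c4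
  set Q := qchoose (n : ℚ) i / qchoose (k : ℚ) i * Kraw i x ((k : ℚ) - y) ((r : ℚ) - 1) with hQ
  have q0 : qdual r n k i j x y = Q * Hahn j y ((n : ℚ) - i) ((k : ℚ) - i) := by
    rw [qdual, if_neg (by omega), hQ]
    simp only [Int.toNat_natCast, Int.cast_natCast]
  have q1 : qdual r n k i ((j : ℤ) + 1) x y
      = Q * Hahn (j + 1) y ((n : ℚ) - i) ((k : ℚ) - i) := by
    have e : ((j : ℤ) + 1).toNat = j + 1 := by omega
    rw [qdual, if_neg (by omega), e, hQ]
    simp only [Int.toNat_natCast, Int.cast_natCast]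
  have q2 : qdual r n k i ((j : ℤ) - 1) x y
      = Q * HahnZ ((j : ℤ) - 1) y ((n : ℚ) - i) ((k : ℚ) - i) := by
    by_cases h : (j : ℤ) - 1 < 0
    · simp [qdual, HahnZ, h]
    · rw [qdual, if_neg (by omega), HahnZ, if_neg h, hQ]
      simp only [Int.toNat_natCast, Int.cast_natCast]
  rw [q0, q1, q2]
  clear_value Q
  have d1 : 2 * (j : ℚ) + i - n = 2 * j - (n - i) := by ring
  rw [d1]
  generalize Hahn j y ((n : ℚ) - i) ((k : ℚ) - i) = H0 at *
  generalize Hahn (j + 1) y ((n : ℚ) - i) ((k : ℚ) - i) = H1 at *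
  generalize HahnZ ((j : ℤ) - 1) y ((n : ℚ) - i) ((k : ℚ) - i) = H2 at *
  simp only [div_eq_mul_inv, mul_inv] at key ⊢
  generalize (2 * (j : ℚ) - (n - i))⁻¹ = D0 at *
  generalize (2 * (j : ℚ) - (n - i) + 1)⁻¹ = D1 at *
  generalize (2 * (j : ℚ) - (n - i) - 2)⁻¹ = D2 at *
  generalize (2 * (j : ℚ) - (n - i) - 3)⁻¹ = D3 at *
  generalize ((n : ℚ) - k)⁻¹ = D4 at *
  linear_combination ((n : ℚ) - 1) * n * (k : ℚ)⁻¹ * D4 * Q * key
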